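/- arXiv:dg-ga/9511001 — 2 statements merged into one kernel-verified Lean document; each statement's English description precedes it below -/
import Mathlib

section
/- Every domain-minimal quadratic harmonic morphism which is not range-maximal can be extended to a range-maximal one by adding component functions: if φ = (φ¹,…,φ^{n+1}): ℝ^{2m(n)} → ℝ^{n+1} is a domain-minimal quadratic harmonic morphism with n < σ(m(n)), then there exist quadratic forms φ^{n+2},…,φ^{σ(m(n))+1} on ℝ^{2m(n)} such that (φ¹,…,φ^{σ(m(n))+1}): ℝ^{2m(n)} → ℝ^{σ(m(n))+1} is a quadratic harmonic morphism. Likewise, every O-system (τ₁,…,τₙ) ∈ O(m(n),n) with n < σ(m(n)) extends, by adding members τ_{n+1},…,τ_{σ(m(n))}, to an O-system in O(m(n),σ(m(n))). -/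
open Matrix BigOperators

/-- Partial derivative in the `i`-th coordinate direction. -/
noncomputable def pderiv {m : ℕ} (i : Fin m) (f : (Fin m → ℝ) → ℝ) : (Fin m → ℝ) → ℝ :=
  fun x => fderiv ℝ f x (Pi.single i 1)

/-- A map `ℝ^m → ℝ^n` is a harmonic morphism iff each component is harmonic and
the map is horizontally weakly conformal. -/
def IsHarmonicMorphism {m n : ℕ} (φ : (Fin m → ℝ) → (Fin n → ℝ)) : Prop :=
  (∀ (α : Fin n) (x : Fin m → ℝ), ∑ i : Fin m, pderiv i (pderiv i fun y => φ y α) x = 0) ∧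
  ∃ lam : (Fin m → ℝ) → ℝ, ∀ (x : Fin m → ℝ) (α β : Fin n),
      ∑ i : Fin m, pderiv i (fun y => φ y α) x * pderiv i (fun y => φ y β) x
        = lam x ^ 2 * (if α = β then 1 else 0)

/-- `A` is the family of symmetric component matrices of the quadratic map `φ`;
the components are genuine (nonzero) quadratic forms. -/
def Represents {m n : ℕ} (A : Fin n → Matrix (Fin m) (Fin m) ℝ)
    (φ : (Fin m → ℝ) → (Fin n → ℝ)) : Prop :=
  (∀ α, (A α).IsSymm) ∧ (∀ α, A α ≠ 0) ∧ ∀ x α, φ x α = x ⬝ᵥ (A α).mulVec x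

/-- A quadratic harmonic morphism. -/
def IsQuadraticHM {m n : ℕ} (φ : (Fin m → ℝ) → (Fin n → ℝ)) : Prop :=
  (∃ A, Represents A φ) ∧ IsHarmonicMorphism φ

/-- `μ` is an eigenvalue of `A`. -/
def HasEigen {m : ℕ} (A : Matrix (Fin m) (Fin m) ℝ) (μ : ℝ) : Prop :=
  ∃ v : Fin m → ℝ, v ≠ 0 ∧ A.mulVec v = μ • v

/-- `φ` is Q-nonsingular: the common rank of the component matrices equals the
domain dimension. -/
def QNonsingular {m n : ℕ} (φ : (Fin m → ℝ) → (Fin n → ℝ)) : Prop :=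
  ∃ A, Represents A φ ∧ ∀ α, (A α).rank = m

/-- `φ` is umbilical: all positive eigenvalues of the component matrices are equal. -/
def Umbilical {m n : ℕ} (φ : (Fin m → ℝ) → (Fin n → ℝ)) : Prop :=
  ∃ A, Represents A φ ∧ ∀ (α : Fin n) (μ ν : ℝ), 0 < μ → 0 < ν →
    HasEigen (A α) μ → HasEigen (A α) ν → μ = ν

/-- `φ ∈ H₂¹(m,n)`: umbilical quadratic harmonic morphism with positive eigenvalue 1. -/
def MemH21 {m n : ℕ} (φ : (Fin m → ℝ) → (Fin n → ℝ)) : Prop :=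
  IsQuadraticHM φ ∧ ∃ A, Represents A φ ∧
    ∀ α : Fin n, HasEigen (A α) 1 ∧ ∀ μ : ℝ, 0 < μ → HasEigen (A α) μ → μ = 1

/-- `G` is an orthogonal matrix. -/
def IsOrthoMat {m : ℕ} (G : Matrix (Fin m) (Fin m) ℝ) : Prop := Gᵀ * G = 1

/-- Domain-equivalence: `φ = ψ ∘ G` for an orthogonal `G`. -/
def DomainEquiv {m n : ℕ} (φ ψ : (Fin m → ℝ) → (Fin n → ℝ)) : Prop :=
  ∃ G : Matrix (Fin m) (Fin m) ℝ, IsOrthoMat G ∧ ∀ x, φ x = ψ (G.mulVec x)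

/-- Bi-equivalence: `φ = H⁻¹ ∘ ψ ∘ G` for orthogonal `G`, `H`. -/
def BiEquiv {m n : ℕ} (φ ψ : (Fin m → ℝ) → (Fin n → ℝ)) : Prop :=
  ∃ (G : Matrix (Fin m) (Fin m) ℝ) (H : Matrix (Fin n) (Fin n) ℝ),
    IsOrthoMat G ∧ IsOrthoMat H ∧ ∀ x, φ x = H⁻¹.mulVec (ψ (G.mulVec x))

/-- A Clifford system: symmetric endomorphisms with `PᵢPⱼ + PⱼPᵢ = 2δᵢⱼ Id`. -/
def IsCliffordSystem {N n : ℕ} (P : Fin n → Matrix (Fin N) (Fin N) ℝ) : Prop :=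
  (∀ i, (P i).IsSymm) ∧
  ∀ i j, P i * P j + P j * P i =
    if i = j then (2 : ℝ) • (1 : Matrix (Fin N) (Fin N) ℝ) else 0

/-- The map `F` sending a Clifford system to the quadratic map
`X ↦ (⟨P₁X,X⟩,…,⟨PₙX,X⟩)`. -/
def cliffordMap {N n : ℕ} (P : Fin n → Matrix (Fin N) (Fin N) ℝ) :
    (Fin N → ℝ) → Fin n → ℝ := fun X α => X ⬝ᵥ (P α).mulVec X

/-- Algebraic equivalence of Clifford systems. -/
def CliffordAlgEquiv {N n : ℕ} (P Q : Fin n → Matrix (Fin N) (Fin N) ℝ) : Prop :=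
  ∃ A : Matrix (Fin N) (Fin N) ℝ, IsOrthoMat A ∧ ∀ i, Q i = A * P i * Aᵀ

/-- Irreducibility: the space is not a direct sum of two nontrivial invariant subspaces. -/
def CliffordIrreducible {N n : ℕ} (P : Fin n → Matrix (Fin N) (Fin N) ℝ) : Prop :=
  ¬∃ U V : Submodule ℝ (Fin N → ℝ), U ≠ ⊥ ∧ V ≠ ⊥ ∧ IsCompl U V ∧
    (∀ i, ∀ x ∈ U, (P i).mulVec x ∈ U) ∧ ∀ i, ∀ x ∈ V, (P i).mulVec x ∈ V

/-- An O-system: orthogonal endomorphisms with `τᵢᵗτⱼ + τⱼᵗτᵢ = 2δᵢⱼ Id`. -/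
def IsOSystem {m n : ℕ} (τ : Fin n → Matrix (Fin m) (Fin m) ℝ) : Prop :=
  (∀ i, (τ i)ᵀ * τ i = 1) ∧
  ∀ i j, (τ i)ᵀ * τ j + (τ j)ᵀ * τ i =
    if i = j then (2 : ℝ) • (1 : Matrix (Fin m) (Fin m) ℝ) else 0

/-- Algebraic equivalence of O-systems. -/
def OAlgEquiv {m n : ℕ} (τ ρ : Fin n → Matrix (Fin m) (Fin m) ℝ) : Prop :=
  ∃ θ : Matrix (Fin m) (Fin m) ℝ, IsOrthoMat θ ∧ ∀ i, ρ i = θ * τ i * θᵀ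

/-- Block-diagonal direct sum of square matrices. -/
def bdiag {m l : ℕ} (A : Matrix (Fin m) (Fin m) ℝ) (B : Matrix (Fin l) (Fin l) ℝ) :
    Matrix (Fin (m + l)) (Fin (m + l)) ℝ :=
  (Matrix.fromBlocks A 0 0 B).submatrix finSumFinEquiv.symm finSumFinEquiv.symm

/-- The block matrix `[[I,0],[0,-I]]`. -/
def assocP0 (m : ℕ) : Matrix (Fin (m + m)) (Fin (m + m)) ℝ :=
  (Matrix.fromBlocks 1 0 0 (-1)).submatrix finSumFinEquiv.symm finSumFinEquiv.symm

/-- The block matrix `[[0,τ],[τᵗ,0]]`. -/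
def assocPi {m : ℕ} (τ : Matrix (Fin m) (Fin m) ℝ) : Matrix (Fin (m + m)) (Fin (m + m)) ℝ :=
  (Matrix.fromBlocks 0 τ τᵀ 0).submatrix finSumFinEquiv.symm finSumFinEquiv.symm

/-- The Clifford system `(P₀,P₁,…,Pₙ)` associated to an O-system `(τ₁,…,τₙ)`. -/
def assocClifford {m n : ℕ} (τ : Fin n → Matrix (Fin m) (Fin m) ℝ) :
    Fin (n + 1) → Matrix (Fin (m + m)) (Fin (m + m)) ℝ :=
  Fin.cons (assocP0 m) fun j => assocPi (τ j)

/-- Direct sum of two maps: `(φ ⊕ ψ)(x,y) = φ(x) + ψ(y)`. -/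
def dsum {m l n : ℕ} (φ : (Fin m → ℝ) → Fin n → ℝ) (ψ : (Fin l → ℝ) → Fin n → ℝ) :
    (Fin (m + l) → ℝ) → Fin n → ℝ :=
  fun x => φ (fun i => x (Fin.castAdd l i)) + ψ fun j => x (Fin.natAdd m j)

/-- Transport a map along an equality of domain dimensions. -/
def reMap {a b n : ℕ} (h : a = b) (ψ : (Fin b → ℝ) → Fin n → ℝ) :
    (Fin a → ℝ) → Fin n → ℝ := fun x => ψ fun i => x (finCongr h.symm i)

/-- A separable quadratic harmonic morphism. -/
def Separable {M n : ℕ} (φ : (Fin M → ℝ) → Fin n → ℝ) : Prop :=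
  ∃ (m l : ℕ) (h : M = m + l), 0 < m ∧ 0 < l ∧
    ∃ (φ₁ : (Fin m → ℝ) → Fin n → ℝ) (φ₂ : (Fin l → ℝ) → Fin n → ℝ),
      IsQuadraticHM φ₁ ∧ IsQuadraticHM φ₂ ∧ φ = reMap h (dsum φ₁ φ₂)

/-- The `k`-fold direct sum `ψ₁ ⊕ … ⊕ ψₖ` of maps with the same domain dimension. -/
def bigDSum {k M n : ℕ} (ψ : Fin k → (Fin M → ℝ) → Fin n → ℝ) :
    (Fin (k * M) → ℝ) → Fin n → ℝ :=
  fun x => ∑ j : Fin k, ψ j fun i => x (finProdFinEquiv (j, i))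

/-- Domain-minimality: no quadratic harmonic morphism into `ℝ^n` exists from a
smaller-dimensional domain. -/
def DomainMinimal {M n : ℕ} (φ : (Fin M → ℝ) → Fin n → ℝ) : Prop :=
  IsQuadraticHM φ ∧ ∀ M' : ℕ, M' < M → ¬∃ ψ : (Fin M' → ℝ) → Fin n → ℝ, IsQuadraticHM ψ

/-- `m(n)`: dimensions of irreducible Clifford systems;
`m(1)=1, m(2)=2, m(3)=m(4)=4, m(5)=…=m(8)=8, m(n+8)=16m(n)`. -/
def mfun : ℕ → ℕ
  | 0 => 1
  | 1 => 1
  | 2 => 2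
  | 3 => 4
  | 4 => 4
  | 5 => 8
  | 6 => 8
  | 7 => 8
  | 8 => 8
  | n + 9 => 16 * mfun (n + 1)

/-- The Hurwitz–Radon number: for `m = (2r+1)·2^(c+4d)` with `0 ≤ c ≤ 3`,
`σ(m) = 2^c + 8d`. -/
def hrSigma (m : ℕ) : ℕ := 2 ^ (padicValNat 2 m % 4) + 8 * (padicValNat 2 m / 4)


section CliffordAlgebra

variable {ι κ : Type*} [Fintype ι] [DecidableEq ι]

/-- A list of symmetric, pairwise anticommuting involutions. -/
structure IsCliffordList (l : List (Matrix ι ι ℝ)) : Prop where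
  isSymm : ∀ P ∈ l, P.IsSymm
  sq : ∀ P ∈ l, P * P = 1
  anticomm : l.Pairwise fun P Q => P * Q = -(Q * P)

/-- The sign `(-1)^(t(t-1)/2)` of the reversal of `t` anticommuting factors. -/
def reversalSign (t : ℕ) : ℝ := (-1) ^ t.choose 2

theorem reversalSign_succ (t : ℕ) : reversalSign (t + 1) = (-1) ^ t * reversalSign t := by
  simp [reversalSign, Nat.choose_succ_succ' t 1, pow_add]

theorem mul_prod_of_anticomm {P : Matrix ι ι ℝ} {s : List (Matrix ι ι ℝ)}
    (h : ∀ Q ∈ s, P * Q = -(Q * P)) : P * s.prod = (-1 : ℝ) ^ s.length • (s.prod * P) := by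
  induction s with
  | nil => simp
  | cons Q s ih =>
    have h1 := h Q (by simp)
    have h2 := ih fun R hR => h R (by simp [hR])
    rw [List.prod_cons, ← mul_assoc, h1, neg_mul, mul_assoc, h2]
    simp [pow_succ, mul_assoc]

namespace IsCliffordList

variable {l s : List (Matrix ι ι ℝ)} {P : Matrix ι ι ℝ}

theorem sublist (hl : IsCliffordList l) (hs : s.Sublist l) : IsCliffordList s :=
  ⟨fun P hP => hl.isSymm P (hs.subset hP), fun P hP => hl.sq P (hs.subset hP),
    hl.anticomm.sublist hs⟩

theorem transpose_prod (hl : IsCliffordList l) :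
    l.prodᵀ = reversalSign l.length • l.prod := by
  induction l with
  | nil => simp [reversalSign]
  | cons P l ih =>
    have h1 : Pᵀ = P := hl.isSymm P (by simp)
    have h2 := mul_prod_of_anticomm (List.pairwise_cons.1 hl.anticomm).1
    have hs : ((-1 : ℝ) ^ l.length) * (-1) ^ l.length = 1 := by
      rw [← mul_pow]; simp
    rw [List.prod_cons, transpose_mul, h1, ih (hl.sublist (List.sublist_cons_self P l)), h2,
      List.length_cons, reversalSign_succ, smul_smul, mul_right_comm, hs, one_mul, smul_mul_assoc]

theorem prod_mul_transpose (hl : IsCliffordList l) : l.prod * l.prodᵀ = 1 := by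
  induction l with
  | nil => simp
  | cons P l ih =>
    have h1 : Pᵀ = P := hl.isSymm P (by simp)
    rw [List.prod_cons, transpose_mul, h1, mul_assoc, ← mul_assoc l.prod,
      ih (hl.sublist (List.sublist_cons_self P l)), one_mul, hl.sq P (by simp)]

theorem prod_mul_self (hl : IsCliffordList l) :
    l.prod * l.prod = reversalSign l.length • (1 : Matrix ι ι ℝ) := by
  have hs : reversalSign l.length * reversalSign l.length = 1 := by
    rw [reversalSign, ← mul_pow]; simp
  rw [← hl.prod_mul_transpose, hl.transpose_prod, mul_smul_comm, smul_smul, hs, one_smul]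

theorem exists_anticomm_of_sublist (hl : IsCliffordList l) (hs : s.Sublist l)
    (hlt : s.length < l.length) : ∃ P ∈ l, ∀ Q ∈ s, P * Q = -(Q * P) := by
  induction hs with
  | slnil => simp at hlt
  | @cons s l a h _ =>
    exact ⟨a, by simp, fun Q hQ => (List.pairwise_cons.1 hl.anticomm).1 Q (h.subset hQ)⟩
  | @cons_cons s l a h ih =>
    obtain ⟨P, hP, hPs⟩ := ih (hl.sublist (List.sublist_cons_self a l)) (by simpa using hlt)
    refine ⟨P, by simp [hP], fun Q hQ => ?_⟩
    rcases List.mem_cons.1 hQ with rfl | hQ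
    · rw [(List.pairwise_cons.1 hl.anticomm).1 P hP, neg_neg]
    · exact hPs Q hQ

theorem trace_prod_eq_zero_of_even (hl : IsCliffordList l) (hne : l ≠ [])
    (he : Even l.length) : l.prod.trace = 0 := by
  cases l with
  | nil => exact absurd rfl hne
  | cons P l =>
    have h2 := mul_prod_of_anticomm (List.pairwise_cons.1 hl.anticomm).1
    have ho : Odd l.length := by
      simpa [Nat.even_add_one] using he
    rw [ho.neg_one_pow] at h2
    have := congrArg Matrix.trace h2
    rw [trace_smul, trace_mul_comm l.prod P] at this
    rw [List.prod_cons]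
    simp only [smul_eq_mul] at this
    linarith

theorem trace_prod_eq_zero_of_odd (hP : P * P = 1)
    (h : ∀ Q ∈ l, P * Q = -(Q * P)) (ho : Odd l.length) : l.prod.trace = 0 := by
  have h2 := mul_prod_of_anticomm h
  rw [ho.neg_one_pow] at h2
  have h3 : l.prod = -(P * l.prod * P) := by
    rw [h2, smul_mul_assoc, mul_assoc, hP, mul_one]; simp
  have := congrArg Matrix.trace h3
  rw [trace_neg, trace_mul_comm, ← mul_assoc, hP, one_mul] at this
  linarith

/-- Products of nonempty sublists are traceless: in the excluded case `l.length % 4 = 1` the full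
product is central and symmetric. -/
theorem trace_prod_sublist (hl : IsCliffordList l)
    (hN : Even l.length ∨ l.length % 4 = 3) (hs : s.Sublist l) (hne : s ≠ []) :
    s.prod.trace = 0 := by
  rcases Nat.even_or_odd s.length with he | ho
  · exact (hl.sublist hs).trace_prod_eq_zero_of_even hne he
  rcases hs.length_le.lt_or_eq with hlt | heq
  · obtain ⟨P, hP, h⟩ := hl.exists_anticomm_of_sublist hs hlt
    exact trace_prod_eq_zero_of_odd (hl.sq P hP) h ho
  · have h4 : s.length % 4 = 3 := by
      rcases hN with h | h
      · rw [← heq] at h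
        exact absurd h (Nat.not_even_iff_odd.2 ho)
      · omega
    have hq : reversalSign s.length = -1 := by
      obtain ⟨k, hk⟩ : ∃ k, s.length = 4 * k + 3 := ⟨s.length / 4, by omega⟩
      have : s.length.choose 2 = 2 * (4 * k ^ 2 + 5 * k + 1) + 1 := by
        rw [hk, Nat.choose_two_right, Nat.add_sub_assoc (by norm_num)]
        apply Nat.div_eq_of_eq_mul_left (by norm_num)
        norm_num
        ring
      rw [reversalSign, this, pow_succ, pow_mul]
      simp
    have := congrArg Matrix.trace (hl.sublist hs).transpose_prod
    rw [trace_transpose, hq, trace_smul, smul_eq_mul] at this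
    linarith

end IsCliffordList

/-- The sum of `ε ^ t * reversalSign t` over the subsets, of size `t`, of an `N`-element set. -/
def signSum : ℝ → ℕ → ℝ
  | _, 0 => 1
  | ε, N + 1 => signSum ε N + ε * signSum (-ε) N

theorem signSum_eq {α : Type*} (ε : ℝ) (l : List α) :
    (l.sublists'.map fun s => ε ^ s.length * reversalSign s.length).sum
      = signSum ε l.length := by
  induction l generalizing ε with
  | nil => simp [signSum, reversalSign]
  | cons a l ih =>
    rw [List.sublists'_cons, List.map_append, List.sum_append, ih, List.length_cons, signSum,
      ← ih (-ε), List.map_map, ← List.sum_map_mul_left]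
    congr 3
    funext s
    simp only [Function.comp_apply, List.length_cons, reversalSign_succ, neg_pow ε]
    ring

theorem sum_map_sublists'_of_forall_ne_nil {α : Type*} {l : List α} {f : List α → ℝ}
    (h : ∀ s : List α, s.Sublist l → s ≠ [] → f s = 0) : (l.sublists'.map f).sum = f [] := by
  induction l with
  | nil => simp
  | cons a l ih =>
    rw [List.sublists'_cons, List.map_append, List.sum_append,
      ih fun s hs => h s (hs.cons a), List.map_map, List.sum_eq_zero, add_zero]
    intro x hx
    obtain ⟨s, hs, rfl⟩ := List.mem_map.1 hx
    exact h _ ((List.mem_sublists'.1 hs).cons_cons a) (List.cons_ne_nil a s)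

theorem signSum_add_eight {ε : ℝ} (hε : ε * ε = 1) (N : ℕ) :
    signSum ε (N + 8) = 16 * signSum ε N := by
  have h : (ε - 1) * (ε + 1) = 0 := by linarith
  rcases mul_eq_zero.1 h with h | h
  · obtain rfl : ε = 1 := by linarith
    simp only [signSum, neg_neg]; ring
  · obtain rfl : ε = -1 := by linarith
    simp only [signSum, neg_neg]; ring

theorem signSum_eight_mul_add {ε : ℝ} (hε : ε * ε = 1) (k r : ℕ) :
    signSum ε (8 * k + r) = 16 ^ k * signSum ε r := by
  induction k with
  | zero => simp
  | succ k ih =>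
    rw [show 8 * (k + 1) + r = 8 * k + r + 8 by ring, signSum_add_eight hε, ih]; ring

/-- The symmetric matrices that commute with the members of `l` up to the factor `ε`. -/
def symmTwistedCommutant (ε : ℝ) (l : List (Matrix ι ι ℝ)) : Submodule ℝ (Matrix ι ι ℝ) where
  carrier := {X | Xᵀ = X ∧ ∀ P ∈ l, P * X = ε • (X * P)}
  zero_mem' := by simp
  add_mem' := by
    rintro X Y ⟨hX, hX'⟩ ⟨hY, hY'⟩
    exact ⟨by rw [transpose_add, hX, hY], fun P hP => by
      rw [mul_add, hX' P hP, hY' P hP, add_mul, smul_add]⟩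
  smul_mem' := by
    rintro c X ⟨hX, hX'⟩
    exact ⟨by rw [transpose_smul, hX], fun P hP => by
      rw [mul_smul_comm, hX' P hP, smul_mul_assoc, smul_comm]⟩

theorem mem_symmTwistedCommutant {ε : ℝ} {l : List (Matrix ι ι ℝ)} {X : Matrix ι ι ℝ} :
    X ∈ symmTwistedCommutant ε l ↔ Xᵀ = X ∧ ∀ P ∈ l, P * X = ε • (X * P) :=
  Iff.rfl

/-- The linear map `X ↦ A (X + Xᵀ) Aᵀ`. -/
def symmConj (A : Matrix ι ι ℝ) : Matrix ι ι ℝ →ₗ[ℝ] Matrix ι ι ℝ where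
  toFun X := A * (X + Xᵀ) * Aᵀ
  map_add' X Y := by rw [transpose_add]; noncomm_ring
  map_smul' c X := by simp [← smul_add]

theorem symmConj_apply (A X : Matrix ι ι ℝ) : symmConj A X = A * (X + Xᵀ) * Aᵀ := rfl

theorem trace_symmConj (A : Matrix ι ι ℝ) :
    LinearMap.trace ℝ _ (symmConj A) = A.trace ^ 2 + (A * A).trace := by
  rw [LinearMap.trace_eq_matrix_trace ℝ (Matrix.stdBasis ℝ ι ι), Matrix.trace]
  have h : ∀ i j : ι, ((stdBasis ℝ ι ι).repr (symmConj A (single i j 1))) (i, j)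
      = A i i * A j j + A i j * A j i := by
    intro i j
    have : ∀ X : Matrix ι ι ℝ, (stdBasis ℝ ι ι).repr X (i, j) = X i j := fun X => by
      simp [stdBasis]
    rw [this, symmConj_apply, transpose_single, mul_add, add_mul, Matrix.add_apply]
    simp [Matrix.mul_apply, Matrix.single_apply, ite_and, Finset.sum_ite_eq]
  simp only [Matrix.diag_apply, LinearMap.toMatrix_apply, Fintype.sum_prod_type,
    stdBasis_eq_single, h, Finset.sum_add_distrib]
  simp [Matrix.trace, Matrix.mul_apply, sq, Finset.sum_mul_sum]

/-- Up to the scalar `2 ^ (l.length + 1)`, the projection onto `symmTwistedCommutant ε l`. -/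
def twistedAverage (ε : ℝ) (l : List (Matrix ι ι ℝ)) : Matrix ι ι ℝ →ₗ[ℝ] Matrix ι ι ℝ :=
  (l.sublists'.map fun s => ε ^ s.length • symmConj s.prod).sum

theorem twistedAverage_nil (ε : ℝ) (X : Matrix ι ι ℝ) :
    twistedAverage ε [] X = X + Xᵀ := by
  simp [twistedAverage, symmConj_apply]

theorem twistedAverage_cons (ε : ℝ) {P : Matrix ι ι ℝ} (hP : P.IsSymm) (l : List (Matrix ι ι ℝ))
    (X : Matrix ι ι ℝ) : twistedAverage ε (P :: l) X =
      twistedAverage ε l X + ε • (P * twistedAverage ε l X * P) := by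
  have key : ∀ L : List (List (Matrix ι ι ℝ)),
      (L.map ((fun s => ε ^ s.length • symmConj s.prod) ∘ List.cons P)).sum X =
        ε • (P * (L.map fun s => ε ^ s.length • symmConj s.prod).sum X * P) := by
    intro L
    induction L with
    | nil => simp
    | cons s L ih =>
      simp only [List.map_cons, List.sum_cons, LinearMap.add_apply, ih]
      simp only [Function.comp_apply, List.length_cons, List.prod_cons, LinearMap.smul_apply,
        symmConj_apply, transpose_mul, hP.eq, mul_add, add_mul, smul_add, mul_assoc, pow_succ',
        mul_smul_comm, smul_mul_assoc, smul_smul]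
  rw [twistedAverage, List.sublists'_cons, List.map_append, List.sum_append, List.map_map,
    LinearMap.add_apply, key, ← twistedAverage]

namespace IsCliffordList

variable {l : List (Matrix ι ι ℝ)} {ε : ℝ}

theorem twistedAverage_mem (hl : IsCliffordList l) (hε : ε * ε = 1) (X : Matrix ι ι ℝ) :
    twistedAverage ε l X ∈ symmTwistedCommutant ε l := by
  induction l with
  | nil => simp [mem_symmTwistedCommutant, twistedAverage_nil, add_comm]
  | cons P l ih =>
    have hP := hl.isSymm P (by simp)
    have hPP := hl.sq P (by simp)
    obtain ⟨h1, h2⟩ := ih (hl.sublist (List.sublist_cons_self P l))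
    rw [twistedAverage_cons ε hP]
    set Y := twistedAverage ε l X
    refine ⟨by simp [hP.eq, h1, mul_assoc], fun Q hQ => ?_⟩
    rcases List.mem_cons.1 hQ with rfl | hQ
    · rw [mul_add, mul_smul_comm, ← mul_assoc, ← mul_assoc, hPP, one_mul, add_mul,
        smul_mul_assoc, mul_assoc _ Q Q, hPP, mul_one, smul_add, smul_smul, hε, one_smul, add_comm]
    · have hPQ := (List.pairwise_cons.1 hl.anticomm).1 Q hQ
      have hQP : Q * P = -(P * Q) := by rw [hPQ, neg_neg]
      have : Q * (P * Y * P) = ε • (P * Y * P * Q) := by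
        rw [← mul_assoc, ← mul_assoc, hQP, neg_mul, neg_mul, mul_assoc P, h2 Q hQ, mul_smul_comm,
          smul_mul_assoc, ← mul_assoc, mul_assoc _ Q P, hQP, mul_neg, smul_neg, neg_neg,
          ← mul_assoc]
      rw [mul_add, h2 Q hQ, mul_smul_comm, this, add_mul, smul_mul_assoc, smul_add]

theorem twistedAverage_of_mem (hl : IsCliffordList l) (hε : ε * ε = 1) {X : Matrix ι ι ℝ}
    (hX : X ∈ symmTwistedCommutant ε l) : twistedAverage ε l X = (2 : ℝ) ^ (l.length + 1) • X := by
  induction l with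
  | nil => rw [twistedAverage_nil, hX.1]; simp [two_smul]
  | cons P l ih =>
    rw [twistedAverage_cons ε (hl.isSymm P (by simp)),
      ih (hl.sublist (List.sublist_cons_self P l)) ⟨hX.1, fun Q hQ => hX.2 Q (by simp [hQ])⟩,
      mul_smul_comm, hX.2 P (by simp), smul_mul_assoc, smul_mul_assoc, mul_assoc,
      hl.sq P (by simp), mul_one, smul_comm, smul_smul ε ε, hε, one_smul, List.length_cons,
      pow_succ _ (l.length + 1), mul_smul, two_smul, smul_add]

theorem trace_twistedAverage (hl : IsCliffordList l)
    (hN : Even l.length ∨ l.length % 4 = 3) :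
    LinearMap.trace ℝ _ (twistedAverage ε l) =
      (Fintype.card ι : ℝ) ^ 2 + Fintype.card ι * signSum ε l.length := by
  have hs : ∀ s ∈ l.sublists', (LinearMap.trace ℝ _ ∘ fun s : List (Matrix ι ι ℝ) =>
      ε ^ s.length • symmConj s.prod) s = ε ^ s.length * s.prod.trace ^ 2 +
        Fintype.card ι * (ε ^ s.length * reversalSign s.length) := by
    intro s hs
    rw [Function.comp_apply, map_smul, trace_symmConj,
      (hl.sublist (List.mem_sublists'.1 hs)).prod_mul_self, trace_smul, trace_one, smul_eq_mul,
      smul_eq_mul]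
    ring
  rw [twistedAverage, map_list_sum, List.map_map, List.map_congr_left hs, List.sum_map_add,
    List.sum_map_mul_left, signSum_eq, sum_map_sublists'_of_forall_ne_nil]
  · simp
  · intro s hs hne
    rw [hl.trace_prod_sublist hN hs hne]
    simp

theorem finrank_symmTwistedCommutant (hl : IsCliffordList l) (hε : ε * ε = 1)
    (hN : Even l.length ∨ l.length % 4 = 3) :
    2 ^ (l.length + 1) * (Module.finrank ℝ (symmTwistedCommutant ε l) : ℝ) =
      (Fintype.card ι : ℝ) ^ 2 + Fintype.card ι * signSum ε l.length := by
  have hp : LinearMap.IsProj (symmTwistedCommutant ε l)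
      (((2 : ℝ) ^ (l.length + 1))⁻¹ • twistedAverage ε l) := by
    refine ⟨fun X => Submodule.smul_mem _ _ (hl.twistedAverage_mem hε X), fun X hX => ?_⟩
    rw [LinearMap.smul_apply, hl.twistedAverage_of_mem hε hX, smul_smul,
      inv_mul_cancel₀ (by positivity), one_smul]
  rw [← hp.trace, map_smul, hl.trace_twistedAverage hN, smul_eq_mul,
    mul_inv_cancel_left₀ (by positivity)]

end IsCliffordList

/-- A family of symmetric, pairwise anticommuting involutions. -/
structure IsCliffordFamily (P : κ → Matrix ι ι ℝ) : Prop where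
  isSymm : ∀ i, (P i).IsSymm
  sq : ∀ i, P i * P i = 1
  anticomm : ∀ i j, i ≠ j → P i * P j = -(P j * P i)

/-- The numerical conditions, satisfied by `N ≡ 4, 6 (mod 8)` and `e = 2 ^ (N / 2)`, under which
`N` anticommuting symmetric involutions need a space of dimension `2 * e`. -/
structure IsQuaternionicDegree (N : ℕ) (e : ℝ) : Prop where
  even : Even N
  pos : 0 < e
  signSum_eq : signSum 1 N = -e
  two_pow : 2 ^ (N + 1) = 2 * e ^ 2

theorem isQuaternionicDegree_four (k : ℕ) : IsQuaternionicDegree (8 * k + 4) (16 ^ k * 4) where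
  even := ⟨4 * k + 2, by ring⟩
  pos := by positivity
  signSum_eq := by
    rw [signSum_eight_mul_add (by norm_num)]; norm_num [signSum]
  two_pow := by
    rw [show 8 * k + 4 + 1 = 4 * k + 4 * k + 5 by ring, pow_add, pow_add, pow_mul]; norm_num; ring

theorem isQuaternionicDegree_six (k : ℕ) : IsQuaternionicDegree (8 * k + 6) (16 ^ k * 8) where
  even := ⟨4 * k + 3, by ring⟩
  pos := by positivity
  signSum_eq := by
    rw [signSum_eight_mul_add (by norm_num)]; norm_num [signSum]
  two_pow := by
    rw [show 8 * k + 6 + 1 = 4 * k + 4 * k + 7 by ring, pow_add, pow_add, pow_mul]; norm_num; ring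

namespace IsCliffordFamily

theorem comp {κ' : Type*} {P : κ → Matrix ι ι ℝ} (hP : IsCliffordFamily P) {f : κ' → κ}
    (hf : Function.Injective f) : IsCliffordFamily fun i => P (f i) :=
  ⟨fun _ => hP.isSymm _, fun _ => hP.sq _, fun _ _ h => hP.anticomm _ _ (hf.ne h)⟩

theorem isCliffordList {N : ℕ} {P : Fin N → Matrix ι ι ℝ} (hP : IsCliffordFamily P) :
    IsCliffordList (List.ofFn P) where
  isSymm := by simpa [List.forall_mem_ofFn_iff] using hP.isSymm
  sq := by simpa [List.forall_mem_ofFn_iff] using hP.sq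
  anticomm := List.pairwise_ofFn.2 fun _ _ h => hP.anticomm _ _ h.ne

variable {N : ℕ} {e : ℝ} {P : Fin N → Matrix ι ι ℝ}

theorem two_mul_le_card [Nonempty ι] (hP : IsCliffordFamily P) (hN : IsQuaternionicDegree N e) :
    2 * e ≤ Fintype.card ι := by
  have h := hP.isCliffordList.finrank_symmTwistedCommutant (ε := 1) (by norm_num)
    (by simpa using Or.inl hN.even)
  rw [List.length_ofFn, hN.signSum_eq, hN.two_pow] at h
  have h1 : (1 : Matrix ι ι ℝ) ∈ symmTwistedCommutant 1 (List.ofFn P) := by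
    simp [mem_symmTwistedCommutant]
  have h2 : symmTwistedCommutant 1 (List.ofFn P) ≠ ⊥ := fun hb => by
    rw [hb, Submodule.mem_bot] at h1
    exact one_ne_zero h1
  have h3 : 1 ≤ Module.finrank ℝ (symmTwistedCommutant 1 (List.ofFn P)) :=
    Nat.one_le_iff_ne_zero.2 fun h0 => h2 (Submodule.finrank_eq_zero.1 h0)
  have h4 : (1 : ℝ) ≤ Module.finrank ℝ (symmTwistedCommutant 1 (List.ofFn P)) := by
    exact_mod_cast h3
  have h5 : (0 : ℝ) ≤ Fintype.card ι := by positivity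
  nlinarith [hN.pos, mul_le_mul_of_nonneg_left h4 (sq_nonneg e)]

theorem exists_eq_smul_one (hP : IsCliffordFamily P) (hN : IsQuaternionicDegree N e)
    (hcard : Fintype.card ι = 2 * e) {X : Matrix ι ι ℝ} (hX : Xᵀ = X)
    (hcomm : ∀ i, P i * X = X * P i) : ∃ c : ℝ, X = c • (1 : Matrix ι ι ℝ) := by
  have he := hN.pos
  have : Nonempty ι := by
    by_contra hι
    rw [not_nonempty_iff] at hι
    simp at hcard
    linarith
  have h := hP.isCliffordList.finrank_symmTwistedCommutant (ε := 1) (by norm_num)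
    (by simpa using Or.inl hN.even)
  rw [List.length_ofFn, hN.signSum_eq, hN.two_pow, hcard] at h
  have h1 : (1 : Matrix ι ι ℝ) ∈ symmTwistedCommutant 1 (List.ofFn P) := by
    simp [mem_symmTwistedCommutant]
  have hX' : X ∈ symmTwistedCommutant 1 (List.ofFn P) :=
    ⟨hX, by simpa [List.forall_mem_ofFn_iff] using hcomm⟩
  have h2 : (Module.finrank ℝ (symmTwistedCommutant 1 (List.ofFn P)) : ℝ) = 1 := by
    have : (2 * e ^ 2) ≠ 0 := by positivity
    apply mul_left_cancel₀ this
    linarith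
  obtain ⟨c, hc⟩ := (finrank_eq_one_iff_of_nonzero' (⟨1, h1⟩ : symmTwistedCommutant 1 (List.ofFn P))
    (fun h0 => one_ne_zero (congrArg Subtype.val h0))).1 (by exact_mod_cast h2) ⟨X, hX'⟩
  exact ⟨c, (congrArg Subtype.val hc).symm⟩

/-- A Clifford family whose first `N₀` members act irreducibly extends by one member. -/
theorem exists_anticomm {N₀ : ℕ} (hP : IsCliffordFamily P) (hle : N₀ ≤ N)
    (hN₀ : IsQuaternionicDegree N₀ e) (hcard : Fintype.card ι = 2 * e)
    (hN : Even N ∨ N % 4 = 3) (hsum : -(2 * e) < signSum (-1) N) :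
    ∃ Q : Matrix ι ι ℝ, Q.IsSymm ∧ Q * Q = 1 ∧ ∀ i, P i * Q = -(Q * P i) := by
  have he := hN₀.pos
  have h := hP.isCliffordList.finrank_symmTwistedCommutant (ε := -1) (by norm_num)
    (by simpa using hN)
  rw [List.length_ofFn, hcard] at h
  have hne : symmTwistedCommutant (-1) (List.ofFn P) ≠ ⊥ := fun hb => by
    rw [hb, finrank_bot] at h
    norm_num at h
    nlinarith
  obtain ⟨X, hX, hX0⟩ := Submodule.exists_mem_ne_zero_of_ne_bot hne
  have hXP : ∀ i, P i * X = -(X * P i) := fun i => by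
    simpa using hX.2 (P i) (by simp)
  obtain ⟨c, hc⟩ := (hP.comp (Fin.castLE_injective hle)).exists_eq_smul_one hN₀ hcard
    (X := X * X) (by rw [transpose_mul, hX.1]) fun i => by
      rw [← mul_assoc, hXP, neg_mul, mul_assoc, hXP, mul_neg, neg_neg, mul_assoc]
  have hcpos : 0 < c := by
    obtain ⟨i, j, hij⟩ : ∃ i j, X i j ≠ 0 := by
      by_contra! h0
      exact hX0 (Matrix.ext h0)
    have h1 := congrFun (congrFun hc i) i
    have h2 : ∀ k, X k i = X i k := fun k => congrFun (congrFun hX.1 i) k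
    simp only [Matrix.mul_apply, Matrix.smul_apply, one_apply_eq, smul_eq_mul, mul_one, h2] at h1
    rw [← h1]
    exact Finset.sum_pos' (fun k _ => mul_self_nonneg _) ⟨j, by simp, mul_self_pos.2 hij⟩
  refine ⟨(√c)⁻¹ • X, ?_, ?_, fun i => ?_⟩
  · rw [Matrix.IsSymm, transpose_smul, hX.1]
  · rw [smul_mul_smul_comm, hc, smul_smul, ← mul_inv, Real.mul_self_sqrt hcpos.le,
      inv_mul_cancel₀ hcpos.ne', one_smul]
  · rw [mul_smul_comm, hXP, smul_mul_assoc, smul_neg]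

theorem snoc (hP : IsCliffordFamily P) {Q : Matrix ι ι ℝ} (hQ : Q.IsSymm) (hQQ : Q * Q = 1)
    (hPQ : ∀ i, P i * Q = -(Q * P i)) :
    IsCliffordFamily (Fin.snoc P Q : Fin (N + 1) → Matrix ι ι ℝ) where
  isSymm := fun i => by
    induction i using Fin.lastCases with
    | last => simpa using hQ
    | cast i => simpa using hP.isSymm i
  sq := fun i => by
    induction i using Fin.lastCases with
    | last => simpa using hQQ
    | cast i => simpa using hP.sq i
  anticomm i j hij := by
    induction i using Fin.lastCases with
    | last =>
      induction j using Fin.lastCases with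
      | last => exact absurd rfl hij
      | cast j => simp [hPQ]
    | cast i =>
      induction j using Fin.lastCases with
      | last => simp [hPQ]
      | cast j =>
        simpa using hP.anticomm i j fun h => hij (by rw [h])

theorem exists_extension {N₀ N₁ : ℕ} (hN₀ : IsQuaternionicDegree N₀ e)
    (hcard : Fintype.card ι = 2 * e)
    (hstep : ∀ M, N₀ ≤ M → M < N₁ → (Even M ∨ M % 4 = 3) ∧ -(2 * e) < signSum (-1) M)
    (hP : IsCliffordFamily P) (h₀ : N₀ ≤ N) (h₁ : N ≤ N₁) :
    ∃ P' : Fin N₁ → Matrix ι ι ℝ, IsCliffordFamily P' ∧ ∀ i, P' (Fin.castLE h₁ i) = P i := by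
  obtain ⟨d, rfl⟩ := Nat.exists_eq_add_of_le h₁
  induction d generalizing N with
  | zero => exact ⟨P, hP, fun i => rfl⟩
  | succ d ih =>
    obtain ⟨hM, hsum⟩ := hstep N h₀ (by omega)
    obtain ⟨Q, hQ, hQQ, hPQ⟩ := hP.exists_anticomm h₀ hN₀ hcard hM hsum
    have hs := hP.snoc hQ hQQ hPQ
    have key : ∀ K, N + 1 + d = K → ∃ P' : Fin K → Matrix ι ι ℝ, IsCliffordFamily P' ∧
        ∀ (h : N + 1 ≤ K) i, P' (Fin.castLE h i) = (Fin.snoc P Q : Fin (N + 1) → _) i := by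
      rintro K rfl
      obtain ⟨P', hP', h'⟩ := ih hs (by omega)
        (fun M h1 h2 => hstep M h1 (by omega)) (by omega)
      exact ⟨P', hP', fun _ i => h' i⟩
    obtain ⟨P', hP', h'⟩ := key (N + (d + 1)) (by omega)
    refine ⟨P', hP', fun i => ?_⟩
    have := h' (by omega) i.castSucc
    rw [Fin.snoc_castSucc] at this
    exact this

end IsCliffordFamily

/-- Symmetric, pairwise anticommuting matrices with a common square `B` restrict to a Clifford
family on each eigenspace of `B`, so in the minimal dimension `B` is a scalar. -/
theorem exists_mul_self_eq_smul_one {N : ℕ} {e : ℝ} (hN : IsQuaternionicDegree N e)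
    (hcard : Fintype.card ι = 2 * e) {A : Fin N → Matrix ι ι ℝ} {B : Matrix ι ι ℝ} (hB0 : B ≠ 0)
    (hA : ∀ i, (A i).IsSymm) (hB : ∀ i, A i * A i = B)
    (hanti : ∀ i j, i ≠ j → A i * A j = -(A j * A i)) :
    ∃ c : ℝ, 0 < c ∧ B = c • (1 : Matrix ι ι ℝ) := by
  have hNpos : 0 < N := by
    rcases Nat.eq_zero_or_pos N with rfl | h
    · have := hN.signSum_eq
      have := hN.pos
      simp only [signSum] at *
      linarith
    · exact h
  have hBs : B.IsHermitian := by
    rw [← hB ⟨0, hNpos⟩, IsHermitian, conjTranspose_eq_transpose_of_trivial, transpose_mul,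
      (hA _).eq]
  set lam := hBs.eigenvalues
  obtain ⟨U, hU1, hU2, hUB⟩ : ∃ U : Matrix ι ι ℝ, Uᵀ * U = 1 ∧ U * Uᵀ = 1 ∧
      B = U * diagonal lam * Uᵀ := by
    refine ⟨hBs.eigenvectorUnitary, ?_, ?_, ?_⟩
    · simpa [star_eq_conjTranspose] using Unitary.coe_star_mul_self hBs.eigenvectorUnitary
    · simpa [star_eq_conjTranspose] using Unitary.coe_mul_star_self hBs.eigenvectorUnitary
    · conv_lhs => rw [hBs.spectral_theorem]
      simp [Unitary.conjStarAlgAut_apply, star_eq_conjTranspose, lam]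
  set A' : Fin N → Matrix ι ι ℝ := fun i => Uᵀ * A i * U with hA'
  have hmul : ∀ i j, A' i * A' j = Uᵀ * (A i * A j) * U := fun i j => by
    calc A' i * A' j = Uᵀ * A i * (U * Uᵀ) * A j * U := by simp only [hA', mul_assoc]
      _ = _ := by rw [hU2, mul_one]; simp only [mul_assoc]
  have hdiag : ∀ i, A' i * A' i = diagonal lam := fun i => by
    rw [hmul, hB, hUB]
    calc _ = (Uᵀ * U) * diagonal lam * (Uᵀ * U) := by simp only [mul_assoc]
      _ = _ := by rw [hU1, one_mul, mul_one]
  have hsymm : ∀ i a b, A' i a b = A' i b a := fun i a b => by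
    have : (A' i)ᵀ = A' i := by simp [hA', (hA i).eq, mul_assoc]
    exact congrFun (congrFun this b) a
  have hzero : ∀ i a b, lam a ≠ lam b → A' i a b = 0 := fun i a b hab => by
    have h1 : diagonal lam * A' i = A' i * diagonal lam := by rw [← hdiag i, mul_assoc]
    have h2 := congrFun (congrFun h1 a) b
    rw [diagonal_mul, mul_diagonal] at h2
    have : (lam a - lam b) * A' i a b = 0 := by linarith
    exact (mul_eq_zero.1 this).resolve_left (sub_ne_zero.2 hab)
  obtain ⟨a₀, ha₀⟩ : ∃ a, lam a ≠ 0 := by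
    by_contra! h0
    exact hB0 (hBs.eigenvalues_eq_zero_iff.1 (funext h0))
  have hc : 0 < lam a₀ := by
    refine lt_of_le_of_ne ?_ ha₀.symm
    have := congrFun (congrFun (hdiag ⟨0, hNpos⟩) a₀) a₀
    rw [diagonal_apply_eq, Matrix.mul_apply] at this
    rw [← this]
    exact Finset.sum_nonneg fun b _ => by rw [hsymm _ b a₀]; exact mul_self_nonneg _
  set c := lam a₀
  let S (X : Matrix ι ι ℝ) : Matrix {a // lam a = c} {a // lam a = c} ℝ :=
    X.submatrix Subtype.val Subtype.val
  have hS : ∀ i j, S (A' i) * S (A' j) = S (A' i * A' j) := fun i j => by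
    ext ⟨a, ha⟩ ⟨b, hb⟩
    simp only [S, Matrix.mul_apply, submatrix_apply]
    rw [← Finset.sum_subtype (Finset.univ.filter fun x => lam x = c) (by simp)
      (fun x => A' i a x * A' j x b)]
    apply Finset.sum_subset (Finset.filter_subset _ _)
    intro x _ hx
    rw [hzero i a x, zero_mul]
    rw [ha]
    intro h
    exact hx (by simp [h])
  have hr : (√c)⁻¹ * (√c)⁻¹ = c⁻¹ := by rw [← mul_inv, Real.mul_self_sqrt hc.le]
  have hP : IsCliffordFamily fun i => (√c)⁻¹ • S (A' i) := by
    refine ⟨fun i => ?_, fun i => ?_, fun i j hij => ?_⟩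
    · ext a b
      simp only [S, transpose_apply, Matrix.smul_apply, submatrix_apply, hsymm i b a]
    · rw [smul_mul_smul_comm, hS, hdiag, hr]
      ext ⟨a, ha⟩ ⟨b, hb⟩
      simp [S, diagonal_apply, one_apply, ha, hc.ne']
    · rw [smul_mul_smul_comm, smul_mul_smul_comm, hS, hS, hmul, hmul, hanti i j hij, ← smul_neg]
      congr 1
      ext a b
      simp [S]
  have : Nonempty {a // lam a = c} := ⟨⟨a₀, rfl⟩⟩
  have hle := hP.two_mul_le_card hN
  rw [← hcard] at hle
  have hall : ∀ a, lam a = c := by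
    have h1 := Fintype.card_subtype_le fun a => lam a = c
    have h2 : Fintype.card {a // lam a = c} = Fintype.card ι := le_antisymm h1 (by exact_mod_cast hle)
    rw [Fintype.card_subtype, Finset.card_eq_iff_eq_univ] at h2
    exact fun a => by simpa using h2.ge (Finset.mem_univ a)
  refine ⟨c, hc, ?_⟩
  rw [hUB, show diagonal lam = c • (1 : Matrix ι ι ℝ) by
    rw [smul_one_eq_diagonal, funext hall], mul_smul_comm, smul_mul_assoc, mul_one, hU2]

end CliffordAlgebra

section QuadraticForms

variable {m n : ℕ}

theorem pderiv_quadraticForm {A : Matrix (Fin m) (Fin m) ℝ} (hA : A.IsSymm) (i : Fin m)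
    (x : Fin m → ℝ) : pderiv i (fun y => y ⬝ᵥ A *ᵥ y) x = 2 * (A *ᵥ x) i := by
  have hd : DifferentiableAt ℝ (fun y : Fin m → ℝ => y ⬝ᵥ A *ᵥ y) x := by
    simp only [dotProduct, mulVec]
    fun_prop
  rw [pderiv, ← hd.lineDeriv_eq_fderiv, lineDeriv]
  set v : Fin m → ℝ := Pi.single i 1
  have hv : x ⬝ᵥ A *ᵥ v = v ⬝ᵥ A *ᵥ x := by
    rw [dotProduct_mulVec, ← mulVec_transpose, hA.eq, dotProduct_comm]
  have h : (fun t : ℝ => (x + t • v) ⬝ᵥ A *ᵥ (x + t • v)) = fun t =>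
      x ⬝ᵥ A *ᵥ x + t * (2 * (v ⬝ᵥ A *ᵥ x)) + t ^ 2 * (v ⬝ᵥ A *ᵥ v) := by
    funext t
    simp only [mulVec_add, mulVec_smul, add_dotProduct, dotProduct_add, smul_dotProduct,
      dotProduct_smul, smul_eq_mul, hv]
    ring
  have h2 : HasDerivAt (fun t : ℝ => x ⬝ᵥ A *ᵥ x + t * (2 * (v ⬝ᵥ A *ᵥ x)) +
      t ^ 2 * (v ⬝ᵥ A *ᵥ v)) (2 * (v ⬝ᵥ A *ᵥ x)) 0 := by
    have := (((hasDerivAt_id (0 : ℝ)).mul_const (2 * (v ⬝ᵥ A *ᵥ x))).const_add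
      (x ⬝ᵥ A *ᵥ x)).add ((hasDerivAt_pow 2 (0 : ℝ)).mul_const (v ⬝ᵥ A *ᵥ v))
    exact this.congr_deriv (by simp)
  rw [h, h2.deriv]
  simp [v]

theorem sum_pderiv_pderiv_quadraticForm {A : Matrix (Fin m) (Fin m) ℝ} (hA : A.IsSymm)
    (x : Fin m → ℝ) : ∑ i, pderiv i (pderiv i fun y => y ⬝ᵥ A *ᵥ y) x = 2 * A.trace := by
  rw [Matrix.trace, Finset.mul_sum]
  refine Finset.sum_congr rfl fun i _ => ?_
  rw [funext (pderiv_quadraticForm hA i), pderiv]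
  have : (fun y : Fin m → ℝ => 2 * (A *ᵥ y) i) =
      ((2 : ℝ) • (LinearMap.proj i ∘ₗ A.mulVecLin)).toContinuousLinearMap := by
    ext y; simp
  rw [this, ContinuousLinearMap.fderiv]
  simp

theorem sum_pderiv_mul_pderiv_quadraticForm {A B : Matrix (Fin m) (Fin m) ℝ} (hA : A.IsSymm)
    (hB : B.IsSymm) (x : Fin m → ℝ) :
    ∑ i, pderiv i (fun y => y ⬝ᵥ A *ᵥ y) x * pderiv i (fun y => y ⬝ᵥ B *ᵥ y) x =
      4 * (x ⬝ᵥ (A * B) *ᵥ x) := by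
  have : x ⬝ᵥ (A * B) *ᵥ x = (A *ᵥ x) ⬝ᵥ (B *ᵥ x) := by
    rw [← mulVec_mulVec, dotProduct_mulVec, ← mulVec_transpose, hA.eq]
  rw [this, dotProduct, Finset.mul_sum]
  refine Finset.sum_congr rfl fun i _ => ?_
  rw [pderiv_quadraticForm hA, pderiv_quadraticForm hB]
  ring

theorem Matrix.add_transpose_eq_zero_of_dotProduct_mulVec {A : Matrix (Fin m) (Fin m) ℝ}
    (h : ∀ x, x ⬝ᵥ A *ᵥ x = 0) : A + Aᵀ = 0 := by
  ext i j
  have h1 := h (Pi.single i 1 + Pi.single j 1)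
  have h2 := h (Pi.single i 1)
  have h3 := h (Pi.single j 1)
  simp only [mulVec_add, add_dotProduct, dotProduct_add, single_dotProduct, mulVec_single,
    MulOpposite.op_one, one_smul, one_mul, col_apply] at h1 h2 h3
  simp only [Matrix.add_apply, transpose_apply, Matrix.zero_apply]
  linarith

/-- The component matrices of a horizontally weakly conformal quadratic map anticommute and have
equal squares. -/
theorem Represents.mul_relations {A : Fin n → Matrix (Fin m) (Fin m) ℝ}
    {φ : (Fin m → ℝ) → Fin n → ℝ} (hA : Represents A φ) (hφ : IsHarmonicMorphism φ) :
    (∀ α β, α ≠ β → A α * A β = -(A β * A α)) ∧ ∀ α β, A α * A α = A β * A β := by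
  obtain ⟨hs, -, hrep⟩ := hA
  obtain ⟨-, lam, hlam⟩ := hφ
  have h : ∀ x α β, 4 * (x ⬝ᵥ (A α * A β) *ᵥ x) = lam x ^ 2 * if α = β then 1 else 0 := by
    intro x α β
    rw [← hlam, ← sum_pderiv_mul_pderiv_quadraticForm (hs α) (hs β)]
    simp only [hrep]
  refine ⟨fun α β hαβ => ?_, fun α β => ?_⟩
  · have := Matrix.add_transpose_eq_zero_of_dotProduct_mulVec (A := A α * A β) fun x => by
      have := h x α β
      rw [if_neg hαβ] at this
      linarith
    rw [transpose_mul, (hs α).eq, (hs β).eq] at this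
    exact eq_neg_of_add_eq_zero_left this
  · have := Matrix.add_transpose_eq_zero_of_dotProduct_mulVec (A := A α * A α - A β * A β)
      fun x => by
        have h1 := h x α α
        have h2 := h x β β
        rw [if_pos rfl] at h1 h2
        rw [sub_mulVec, dotProduct_sub]
        linarith
    rw [transpose_sub, transpose_mul, transpose_mul, (hs α).eq, (hs β).eq, ← two_smul ℝ] at this
    exact sub_eq_zero.1 ((smul_eq_zero.1 this).resolve_left two_ne_zero)

theorem IsCliffordFamily.isQuadraticHM [Nonempty (Fin m)] {P : Fin n → Matrix (Fin m) (Fin m) ℝ}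
    (hP : IsCliffordFamily P) (hn : 2 ≤ n) {r : ℝ} (hr : r ≠ 0) :
    IsQuadraticHM fun (x : Fin m → ℝ) (α : Fin n) => x ⬝ᵥ (r • P α) *ᵥ x := by
  have hs : ∀ α, (r • P α).IsSymm := fun α => by
    rw [Matrix.IsSymm, transpose_smul, (hP.isSymm α).eq]
  refine ⟨⟨fun α => r • P α, hs, fun α h0 => ?_, fun x α => rfl⟩, fun α x => ?_,
    fun x => 2 * r * √(x ⬝ᵥ x), fun x α β => ?_⟩
  · have h1 := hP.sq α
    rw [(smul_eq_zero.1 h0).resolve_left hr, zero_mul] at h1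
    exact zero_ne_one h1
  · have : Nontrivial (Fin n) := Fin.nontrivial_iff_two_le.2 hn
    obtain ⟨β, hβ⟩ := exists_ne α
    have ht := IsCliffordList.trace_prod_eq_zero_of_odd (l := [P α]) (hP.sq β)
      (by simpa using hP.anticomm β α hβ) (by simp)
    rw [sum_pderiv_pderiv_quadraticForm (hs α), trace_smul]
    simp only [List.prod_singleton] at ht
    simp [ht]
  · have hx : 0 ≤ x ⬝ᵥ x := Finset.sum_nonneg fun i _ => mul_self_nonneg _
    rw [sum_pderiv_mul_pderiv_quadraticForm (hs α) (hs β), mul_pow, Real.sq_sqrt hx,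
      smul_mul_smul_comm, smul_mulVec, dotProduct_smul, smul_eq_mul]
    split_ifs with h
    · subst h
      rw [hP.sq, one_mulVec]; ring
    · have h1 : x ⬝ᵥ (P α * P β) *ᵥ x = x ⬝ᵥ (P β * P α) *ᵥ x := by
        conv_lhs => rw [← (hP.isSymm α).eq, ← (hP.isSymm β).eq, ← transpose_mul,
          mulVec_transpose, dotProduct_comm, ← dotProduct_mulVec]
      have h2 := congrArg (fun M => x ⬝ᵥ M *ᵥ x) (hP.anticomm α β h)
      simp only [neg_mulVec, dotProduct_neg, ← h1] at h2
      have h3 : x ⬝ᵥ (P α * P β) *ᵥ x = 0 := by linarith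
      rw [h3]; ring

end QuadraticForms

section OSystems

variable {m n : ℕ}

theorem IsOSystem.isCliffordFamily {τ : Fin n → Matrix (Fin m) (Fin m) ℝ} (hτ : IsOSystem τ) :
    IsCliffordFamily (Fin.cons (fromBlocks 1 0 0 (-1)) fun i => fromBlocks 0 (τ i) (τ i)ᵀ 0 :
      Fin (n + 1) → Matrix (Fin m ⊕ Fin m) (Fin m ⊕ Fin m) ℝ) := by
  have hl := hτ.1
  have hr : ∀ i, τ i * (τ i)ᵀ = 1 := fun i => mul_eq_one_comm.1 (hl i)
  have h1 : ∀ i j, i ≠ j → (τ i)ᵀ * τ j = -((τ j)ᵀ * τ i) := fun i j h => by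
    have := hτ.2 i j
    rw [if_neg h] at this
    exact eq_neg_of_add_eq_zero_left this
  have h2 : ∀ i j, i ≠ j → τ i * (τ j)ᵀ = -(τ j * (τ i)ᵀ) := fun i j h => by
    calc τ i * (τ j)ᵀ = τ i * ((τ j)ᵀ * τ i) * (τ i)ᵀ := by
          rw [mul_assoc, mul_assoc, hr, mul_one]
      _ = -((τ i * (τ i)ᵀ) * (τ j * (τ i)ᵀ)) := by
          rw [h1 j i h.symm]; simp only [mul_neg, neg_mul, mul_assoc]
      _ = _ := by rw [hr, one_mul]
  refine ⟨fun i => ?_, fun i => ?_, fun i j hij => ?_⟩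
  · refine Fin.cases ?_ (fun i => ?_) i
    · simp [Matrix.IsSymm, fromBlocks_transpose]
    · simp [Matrix.IsSymm, fromBlocks_transpose]
  · refine Fin.cases ?_ (fun i => ?_) i
    · simp [fromBlocks_multiply]
    · simp [fromBlocks_multiply, hl, hr]
  · induction i using Fin.cases with
    | zero =>
      induction j using Fin.cases with
      | zero => exact absurd rfl hij
      | succ j => simp [fromBlocks_multiply, fromBlocks_neg]
    | succ i =>
      induction j using Fin.cases with
      | zero => simp [fromBlocks_multiply, fromBlocks_neg]
      | succ j =>
        have h : i ≠ j := fun h => hij (by rw [h])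
        simp [fromBlocks_multiply, fromBlocks_neg, h1 i j h, h2 i j h]

/-- A Clifford family starting with `diag(1, -1)` consists of off-diagonal block matrices, whose
upper right blocks form an O-system. -/
theorem IsCliffordFamily.isOSystem
    {P : Fin (n + 1) → Matrix (Fin m ⊕ Fin m) (Fin m ⊕ Fin m) ℝ} (hP : IsCliffordFamily P)
    (h0 : P 0 = fromBlocks 1 0 0 (-1)) : IsOSystem fun i => (P (Fin.succ i)).toBlocks₁₂ := by
  have hblock : ∀ i : Fin n, P i.succ =
      fromBlocks 0 (P i.succ).toBlocks₁₂ (P i.succ).toBlocks₁₂ᵀ 0 := fun i => by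
    have ha := hP.anticomm 0 i.succ (Fin.succ_ne_zero i).symm
    have hs := (hP.isSymm i.succ).eq
    generalize P i.succ = X at ha hs ⊢
    rw [h0] at ha
    rw [← fromBlocks_toBlocks X] at ha hs
    simp only [fromBlocks_multiply, fromBlocks_transpose, fromBlocks_neg, fromBlocks_inj, one_mul,
      zero_mul, mul_one, mul_zero, add_zero, zero_add, neg_mul, mul_neg, neg_neg] at ha hs
    have key : ∀ Y : Matrix (Fin m) (Fin m) ℝ, Y = -Y → Y = 0 := fun Y h => by
      ext a b
      have := congrFun (congrFun h a) b
      simp only [Matrix.neg_apply, Matrix.zero_apply] at this ⊢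
      linarith
    conv_lhs => rw [← fromBlocks_toBlocks X]
    rw [key _ ha.1, key _ ha.2.2.2.symm, hs.2.2.1]
  have hsq : ∀ i : Fin n, (P i.succ).toBlocks₁₂ᵀ * (P i.succ).toBlocks₁₂ = 1 := fun i => by
    have h := hP.sq i.succ
    rw [hblock i, fromBlocks_multiply, ← fromBlocks_one, fromBlocks_inj] at h
    simpa using h.2.2.2
  refine ⟨hsq, fun i j => ?_⟩
  split_ifs with h
  · subst h
    rw [hsq, two_smul]
  · have h := hP.anticomm i.succ j.succ fun h' => h (Fin.succ_injective _ h')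
    rw [hblock i, hblock j, fromBlocks_multiply, fromBlocks_multiply, fromBlocks_neg,
      fromBlocks_inj] at h
    have := h.2.2.2
    simp only [mul_zero, add_zero] at this
    simp [this]

end OSystems

theorem mfun_eight_mul_add (k r : ℕ) (hr : 1 ≤ r) : mfun (8 * k + r) = 16 ^ k * mfun r := by
  induction k with
  | zero => simp
  | succ k ih =>
    obtain ⟨s, rfl⟩ := Nat.exists_eq_add_of_le' hr
    rw [show 8 * (k + 1) + (s + 1) = 8 * k + s + 9 by ring, mfun,
      show 8 * k + s + 1 = 8 * k + (s + 1) by ring, ih]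
    ring

theorem hrSigma_pow (k j : ℕ) (hj : j < 4) : hrSigma (16 ^ k * 2 ^ j) = 2 ^ j + 8 * k := by
  have : 16 ^ k * 2 ^ j = 2 ^ (4 * k + j) := by rw [pow_add, pow_mul]; norm_num
  rw [hrSigma, this, padicValNat.prime_pow, show (4 * k + j) % 4 = j by omega,
    show (4 * k + j) / 4 = k by omega]

/-- If `n < σ(m(n))`, then some `N₀ ≤ n + 1` is a quaternionic degree with minimal dimension
`2 m(n)`, and the numerical condition for a one-step extension holds from `N₀` up to `σ(m(n))`. -/
theorem exists_isQuaternionicDegree {n : ℕ} (hn : 1 ≤ n) (h : n < hrSigma (mfun n)) :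
    ∃ N₀, IsQuaternionicDegree N₀ (mfun n) ∧ N₀ ≤ n + 1 ∧
      ∀ M, N₀ ≤ M → M < hrSigma (mfun n) + 1 →
        (Even M ∨ M % 4 = 3) ∧ -(2 * (mfun n : ℝ)) < signSum (-1) M := by
  obtain ⟨k, r, hr1, hr8, rfl⟩ : ∃ k r, 1 ≤ r ∧ r ≤ 8 ∧ n = 8 * k + r :=
    ⟨(n - 1) / 8, (n - 1) % 8 + 1, by omega, by omega, by omega⟩
  have hpos : (0 : ℝ) < 16 ^ k := by positivity
  rw [mfun_eight_mul_add k r hr1] at h ⊢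
  have step : ∀ s (b e : ℝ), signSum (-1) s = b → -(2 * e) < b →
      -(2 * (16 ^ k * e)) < signSum (-1) (8 * k + s) := fun s b e h1 h2 => by
    rw [signSum_eight_mul_add (by norm_num), h1]
    nlinarith
  have h2 := hrSigma_pow k 0 (by norm_num)
  have h3 := hrSigma_pow k 1 (by norm_num)
  have h4 := hrSigma_pow k 2 (by norm_num)
  have h8 := hrSigma_pow k 3 (by norm_num)
  norm_num at h2 h3 h4 h8
  have hfour : ∀ M, 8 * k + 4 ≤ M → M < 4 + 8 * k + 1 →
      (Even M ∨ M % 4 = 3) ∧ -(2 * ((16 ^ k * 4 : ℕ) : ℝ)) < signSum (-1) M := by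
    intro M hM hM'
    obtain rfl : M = 8 * k + 4 := by omega
    refine ⟨Or.inl ⟨4 * k + 2, by ring⟩, ?_⟩
    push_cast
    exact step 4 _ _ rfl (by norm_num [signSum])
  have height : ∀ M, 8 * k + 6 ≤ M → M < 8 + 8 * k + 1 →
      (Even M ∨ M % 4 = 3) ∧ -(2 * ((16 ^ k * 8 : ℕ) : ℝ)) < signSum (-1) M := by
    intro M hM hM'
    obtain ⟨s, rfl⟩ := Nat.exists_eq_add_of_le hM
    have hs : s < 3 := by omega
    push_cast
    rw [add_assoc]
    refine ⟨?_, step _ _ _ rfl ?_⟩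
    · interval_cases s
      · exact Or.inl ⟨4 * k + 3, by ring⟩
      · exact Or.inr (by omega)
      · exact Or.inl ⟨4 * k + 4, by ring⟩
    · interval_cases s <;> norm_num [signSum]
  have q4 := isQuaternionicDegree_four k
  have q6 := isQuaternionicDegree_six k
  interval_cases r <;> simp only [mfun, mul_one] at h ⊢
  · omega
  · omega
  · rw [h4]
    exact ⟨8 * k + 4, by exact_mod_cast q4, by omega, hfour⟩
  · omega
  all_goals first
    | omega
    | (rw [h8]; exact ⟨8 * k + 6, by exact_mod_cast q6, by omega, height⟩)

/-- A domain-minimal quadratic harmonic morphism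
`ℝ^{2m(n)} → ℝ^{n+1}` with `n < σ(m(n))` extends, by adding component quadratic
forms, to a quadratic harmonic morphism into `ℝ^{σ(m(n))+1}`; likewise every
O-system in `O(m(n),n)` extends to one in `O(m(n),σ(m(n)))`. -/
theorem domain_minimal_extends_to_range_maximal (n : ℕ) (hn : 1 ≤ n)
    (h : n < hrSigma (mfun n)) :
    (∀ φ : (Fin (2 * mfun n) → ℝ) → Fin (n + 1) → ℝ,
        IsQuadraticHM φ → DomainMinimal φ →
        ∃ Φ : (Fin (2 * mfun n) → ℝ) → Fin (hrSigma (mfun n) + 1) → ℝ,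
          IsQuadraticHM Φ ∧
            ∀ (x : Fin (2 * mfun n) → ℝ) (α : Fin (n + 1)),
              Φ x (Fin.castLE (by omega) α) = φ x α) ∧
    (∀ τ : Fin n → Matrix (Fin (mfun n)) (Fin (mfun n)) ℝ,
        IsOSystem τ →
        ∃ τ' : Fin (hrSigma (mfun n)) → Matrix (Fin (mfun n)) (Fin (mfun n)) ℝ,
          IsOSystem τ' ∧ ∀ i : Fin n, τ' (Fin.castLE (by omega) i) = τ i) := by
  obtain ⟨N₀, hN₀, hle, hstep⟩ := exists_isQuaternionicDegree hn h
  have hmpos : 0 < mfun n := by exact_mod_cast hN₀.pos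
  refine ⟨fun φ hφ _ => ?_, fun τ hτ => ?_⟩
  · have hcard : (Fintype.card (Fin (2 * mfun n)) : ℝ) = 2 * (mfun n : ℝ) := by simp
    have : Nonempty (Fin (2 * mfun n)) := ⟨⟨0, by omega⟩⟩
    obtain ⟨⟨A, hA⟩, hharm⟩ := hφ
    obtain ⟨hanti, hsq⟩ := hA.mul_relations hharm
    have hs := hA.1
    have hB0 : A 0 * A 0 ≠ 0 := fun h0 => hA.2.1 0 (by
      refine conjTranspose_mul_self_eq_zero.1 ?_
      rw [conjTranspose_eq_transpose_of_trivial, (hs 0).eq, h0])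
    obtain ⟨c, hc, hB⟩ := exists_mul_self_eq_smul_one hN₀ hcard hB0
      (A := fun i => A (Fin.castLE hle i)) (fun i => hs _) (fun i => hsq _ _)
      fun i j hij => hanti _ _ ((Fin.castLE_injective hle).ne hij)
    have hc0 : √c ≠ 0 := (Real.sqrt_pos.2 hc).ne'
    have hP : IsCliffordFamily fun α => (√c)⁻¹ • A α := by
      refine ⟨fun α => ?_, fun α => ?_, fun α β hαβ => ?_⟩
      · rw [Matrix.IsSymm, transpose_smul, (hs α).eq]
      · rw [smul_mul_smul_comm, hsq α 0, hB, smul_smul, ← mul_inv, Real.mul_self_sqrt hc.le,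
          inv_mul_cancel₀ hc.ne', one_smul]
      · rw [smul_mul_smul_comm, smul_mul_smul_comm, hanti α β hαβ, smul_neg]
    obtain ⟨P', hP', hext⟩ := hP.exists_extension hN₀ hcard hstep hle (by omega)
    refine ⟨_, hP'.isQuadraticHM (by omega) hc0, fun x α => ?_⟩
    rw [hext, smul_smul, mul_inv_cancel₀ hc0, one_smul, hA.2.2]
  · have hcard : (Fintype.card (Fin (mfun n) ⊕ Fin (mfun n)) : ℝ) = 2 * (mfun n : ℝ) := by
      simp [two_mul]
    obtain ⟨P', hP', hext⟩ := hτ.isCliffordFamily.exists_extension hN₀ hcard hstep hle (by omega)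
    refine ⟨_, hP'.isOSystem (hext 0), fun i => ?_⟩
    have := hext i.succ
    rw [Fin.cons_succ] at this
    rw [show (Fin.castLE (by omega) i : Fin (hrSigma (mfun n))).succ =
      Fin.castLE (by omega) i.succ from rfl, this, toBlocks_fromBlocks₁₂]
end

section
/- Every nonconstant quadratic harmonic morphism φ: ℝ^m → ℝ² is domain-equivalent to the map ψ: ℝ^m → ℝ² ≅ ℂ given by ψ(x₁,…,x_m) = λ₁(x₁+ix₂)² + λ₂(x₃+ix₄)² + … + λₖ(x_{2k-1}+ix_{2k})², where k = ⌊m/2⌋ and λ₁,…,λₖ ≥ 0 are constants with at least one nonzero; that is, φ = ψ∘G for some G ∈ O(m). -/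
open Matrix BigOperators

theorem pderiv_dotProduct_mulVec {m : ℕ} (A : Matrix (Fin m) (Fin m) ℝ) (hA : A.IsSymm)
    (i : Fin m) (x : Fin m → ℝ) :
    pderiv i (fun y => y ⬝ᵥ A *ᵥ y) x = 2 * (A *ᵥ x) i := by
  have hd (k : Fin m) : HasFDerivAt (fun y : Fin m → ℝ => y k)
      (ContinuousLinearMap.proj (R := ℝ) (φ := fun _ : Fin m => ℝ) k) x :=
    hasFDerivAt_apply k x
  have hM (k : Fin m) : HasFDerivAt (fun y : Fin m → ℝ => (A *ᵥ y) k)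
      ((ContinuousLinearMap.proj (R := ℝ) (φ := fun _ : Fin m => ℝ) k).comp
        (Matrix.toLin' A).toContinuousLinearMap) x :=
    ((ContinuousLinearMap.proj (R := ℝ) (φ := fun _ : Fin m => ℝ) k).comp
        (Matrix.toLin' A).toContinuousLinearMap).hasFDerivAt
  have h := HasFDerivAt.fun_sum (u := Finset.univ) fun k _ => (hd k).fun_mul (hM k)
  have hcol : x ⬝ᵥ A.col i = (A *ᵥ x) i := by
    rw [dotProduct_comm]
    simp only [mulVec, dotProduct, Matrix.col_apply]
    exact Finset.sum_congr rfl fun k _ => by rw [hA.apply]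
  rw [pderiv]
  change fderiv ℝ (fun y : Fin m → ℝ => ∑ k, y k * (A *ᵥ y) k) x _ = _
  rw [h.fderiv]
  simp only [dotProduct, Matrix.col_apply] at hcol
  simp [Finset.sum_add_distrib, Pi.single_apply, hcol, two_mul]

section NormalForm

open scoped InnerProductSpace

variable {E : Type*} [NormedAddCommGroup E] [InnerProductSpace ℝ E]

theorem LinearMap.IsSymmetric.comp_eq_comp_of_conformal {A B : E →ₗ[ℝ] E} (hA : A.IsSymmetric)
    (hB : B.IsSymmetric) (hnorm : ∀ x, ⟪A x, A x⟫_ℝ = ⟪B x, B x⟫_ℝ)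
    (horth : ∀ x, ⟪A x, B x⟫_ℝ = 0) :
    (∀ x, A (A x) = B (B x)) ∧ ∀ x, A (B x) = -B (A x) := by
  have hsq : (A ∘ₗ A - B ∘ₗ B).IsSymmetric := fun x y => by
    simp [inner_sub_left, inner_sub_right, hA _ _, hB _ _]
  have hanti : (A ∘ₗ B + B ∘ₗ A).IsSymmetric := fun x y => by
    simp [inner_add_left, inner_add_right, hA _ _, hB _ _, add_comm]
  have h1 := hsq.inner_map_self_eq_zero.mp fun x => by
    simp [inner_sub_left, hA (A x), hB (B x), hnorm x, -inner_self_eq_norm_sq_to_K]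
  have h2 := hanti.inner_map_self_eq_zero.mp fun x => by
    simp [inner_add_left, hA (B x), hB (A x), real_inner_comm (A x) (B x), horth x]
  exact ⟨fun x => sub_eq_zero.mp (LinearMap.congr_fun h1 x),
    fun x => eq_neg_of_add_eq_zero_left (LinearMap.congr_fun h2 x)⟩

variable [FiniteDimensional ℝ E]

theorem exists_orthonormal_pair {S : Submodule ℝ E} (hS : 2 ≤ Module.finrank ℝ S) :
    ∃ v ∈ S, ∃ w ∈ S, ⟪v, v⟫_ℝ = 1 ∧ ⟪w, w⟫_ℝ = 1 ∧ ⟪v, w⟫_ℝ = 0 := by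
  let b := stdOrthonormalBasis ℝ S
  have hb := orthonormal_iff_ite.mp b.orthonormal
  have h (i j) : ⟪(b i : E), b j⟫_ℝ = if i = j then 1 else 0 := hb i j
  refine ⟨b ⟨0, by omega⟩, Subtype.coe_prop _, b ⟨1, by omega⟩, Subtype.coe_prop _, ?_, ?_, ?_⟩
  all_goals simp only [h, Fin.mk.injEq, zero_ne_one, if_true, if_false]

theorem LinearMap.IsSymmetric.exists_unit_eigenvector_ne_zero {A : E →ₗ[ℝ] E}
    (hA : A.IsSymmetric) {S : Submodule ℝ E} (hAS : ∀ x ∈ S, A x ∈ S)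
    (hne : ∃ x ∈ S, A x ≠ 0) :
    ∃ μ : ℝ, μ ≠ 0 ∧ ∃ v ∈ S, ⟪v, v⟫_ℝ = 1 ∧ A v = μ • v := by
  have hT : (A.restrict hAS).IsSymmetric := hA.restrict_invariant hAS
  by_contra! hcon
  obtain ⟨x, hx, hAx⟩ := hne
  have hb := orthonormal_iff_ite.mp (hT.eigenvectorBasis rfl).orthonormal
  have hz : A.restrict hAS = 0 := by
    refine (hT.eigenvectorBasis rfl).toBasis.ext fun i => ?_
    have h := hT.apply_eigenvectorBasis rfl i
    by_cases hi : hT.eigenvalues rfl i = 0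
    · simp [h, hi]
    · refine absurd (congrArg Subtype.val h)
        (hcon (hT.eigenvalues rfl i) hi _ (Subtype.coe_prop _) ?_)
      exact (hb i i).trans (if_pos rfl)
  exact hAx (congrArg Subtype.val (LinearMap.congr_fun hz ⟨x, hx⟩))

/-- An invariant plane inside `S`, with orthonormal basis `v`, `w`, on which `A`, `B` act as `μ • diag(1, -1)` and `μ • [[0, 1], [1, 0]]`. -/
theorem exists_plane_normal_form {A B : E →ₗ[ℝ] E} (hA : A.IsSymmetric) (hB : B.IsSymmetric)
    (hsq : ∀ x, A (A x) = B (B x)) (hanti : ∀ x, A (B x) = -B (A x)) {S : Submodule ℝ E}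
    (hAS : ∀ x ∈ S, A x ∈ S) (hBS : ∀ x ∈ S, B x ∈ S) (hS : 2 ≤ Module.finrank ℝ S) :
    ∃ μ : ℝ, 0 ≤ μ ∧ ∃ v ∈ S, ∃ w ∈ S, ⟪v, v⟫_ℝ = 1 ∧ ⟪w, w⟫_ℝ = 1 ∧ ⟪v, w⟫_ℝ = 0 ∧
      A v = μ • v ∧ A w = -(μ • w) ∧ B v = μ • w ∧ B w = μ • v := by
  by_cases hz : ∀ x ∈ S, A x = 0
  · have hz' : ∀ x ∈ S, B x = 0 := fun x hx => by
      rw [← inner_self_eq_zero (𝕜 := ℝ), ← hB, ← hsq, hz x hx]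
      simp
    obtain ⟨v, hv, w, hw, h⟩ := exists_orthonormal_pair hS
    exact ⟨0, le_rfl, v, hv, w, hw, h.1, h.2.1, h.2.2, by simp [hz, hz', hv, hw]⟩
  push Not at hz
  obtain ⟨ν, hν, u, huS, huu, hAu⟩ := hA.exists_unit_eigenvector_ne_zero hAS hz
  obtain ⟨μ, hμ, v, hvS, hvv, hAv⟩ :
      ∃ μ : ℝ, 0 < μ ∧ ∃ v ∈ S, ⟪v, v⟫_ℝ = 1 ∧ A v = μ • v := by
    rcases hν.lt_or_gt with hneg | hpos
    · refine ⟨-ν, by linarith, ν⁻¹ • B u, S.smul_mem _ (hBS u huS), ?_, ?_⟩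
      · rw [inner_smul_left, inner_smul_right, hB, ← hsq, hAu, map_smul, hAu]
        simp only [inner_smul_right, huu, conj_trivial]
        field_simp
      · simp [hanti, hAu, smul_smul, mul_comm]
    · exact ⟨ν, hpos, u, huS, huu, hAu⟩
  have hAw : A (μ⁻¹ • B v) = -(μ • μ⁻¹ • B v) := by
    simp [hanti, hAv, smul_smul, mul_comm]
  refine ⟨μ, hμ.le, v, hvS, μ⁻¹ • B v, S.smul_mem _ (hBS v hvS), hvv, ?_, ?_, hAv, hAw, ?_, ?_⟩
  · rw [inner_smul_left, inner_smul_right, hB, ← hsq, hAv, map_smul, hAv]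
    simp only [inner_smul_right, hvv, conj_trivial]
    field_simp
  · have h := hA v (μ⁻¹ • B v)
    rw [hAw, hAv, inner_neg_right, inner_smul_left, inner_smul_right v _ μ] at h
    simp only [conj_trivial] at h
    have : μ * ⟪v, μ⁻¹ • B v⟫_ℝ = 0 := by linarith
    exact (mul_eq_zero.mp this).resolve_left hμ.ne'
  · rw [smul_smul, mul_inv_cancel₀ hμ.ne', one_smul]
  · rw [map_smul, ← hsq, hAv, map_smul, hAv, smul_smul, inv_mul_cancel₀ hμ.ne', one_smul]

theorem exists_normal_form_on {A B : E →ₗ[ℝ] E} (hA : A.IsSymmetric) (hB : B.IsSymmetric)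
    (hsq : ∀ x, A (A x) = B (B x)) (hanti : ∀ x, A (B x) = -B (A x)) (n : ℕ) :
    ∀ S : Submodule ℝ E, (∀ x ∈ S, A x ∈ S) → (∀ x ∈ S, B x ∈ S) →
      Module.finrank ℝ S = n →
      ∃ (v : ℕ → E) (c : ℕ → ℝ), (∀ i < n, v i ∈ S) ∧ (∀ j, 0 ≤ c j) ∧
        (∀ i < n, ∀ j < n, ⟪v i, v j⟫_ℝ = if i = j then 1 else 0) ∧
        (∀ x ∈ S, ⟪x, A x⟫_ℝ =
          ∑ j ∈ Finset.range (n / 2), c j * (⟪v (2 * j), x⟫_ℝ ^ 2 - ⟪v (2 * j + 1), x⟫_ℝ ^ 2)) ∧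
        (∀ x ∈ S, ⟪x, B x⟫_ℝ =
          ∑ j ∈ Finset.range (n / 2), c j * (2 * ⟪v (2 * j), x⟫_ℝ * ⟪v (2 * j + 1), x⟫_ℝ)) := by
  induction n using Nat.twoStepInduction with
  | zero =>
    intro S _ _ hS
    rw [Submodule.finrank_eq_zero] at hS
    exact ⟨0, 0, by simp [hS]⟩
  | one =>
    intro S hAS hBS hS
    obtain ⟨u, hu0, hu⟩ := finrank_eq_one_iff'.mp hS
    have hu0' : (u : E) ≠ 0 := by simpa using hu0
    obtain ⟨a, ha⟩ := hu ⟨A u, hAS u u.2⟩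
    obtain ⟨b, hb⟩ := hu ⟨B u, hBS u u.2⟩
    replace ha : A u = a • (u : E) := (congrArg Subtype.val ha).symm
    replace hb : B u = b • (u : E) := (congrArg Subtype.val hb).symm
    have h1 : a * a = b * b := by
      have := hsq u
      rw [ha, hb, map_smul, map_smul, ha, hb, smul_smul, smul_smul] at this
      exact smul_left_injective ℝ hu0' this
    have h2 : b * a = -(a * b) := by
      have := hanti u
      rw [ha, hb, map_smul, map_smul, ha, hb, smul_smul, smul_smul, ← neg_smul] at this
      exact smul_left_injective ℝ hu0' this
    have ha0 : a = 0 := by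
      have : a * b = 0 := by linarith
      rcases mul_eq_zero.mp this with h | h
      · exact h
      · simpa [h] using h1
    have hb0 : b = 0 := by simpa [ha0, eq_comm] using h1
    have hz : ∀ x ∈ S, A x = 0 ∧ B x = 0 := fun x hx => by
      obtain ⟨t, ht⟩ := hu ⟨x, hx⟩
      obtain rfl : t • (u : E) = x := congrArg Subtype.val ht
      simp [ha, hb, ha0, hb0]
    refine ⟨fun _ => ‖(u : E)‖⁻¹ • (u : E), 0, fun _ _ => S.smul_mem _ u.2, fun _ => le_rfl, ?_,
      fun x hx => by simp [hz x hx], fun x hx => by simp [hz x hx]⟩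
    intro i hi j hj
    rw [if_pos (by omega), real_inner_self_eq_norm_sq, norm_smul, norm_inv, norm_norm,
      inv_mul_cancel₀ (norm_ne_zero_iff.mpr hu0'), one_pow]
  | more n ih _ =>
    intro S hAS hBS hS
    obtain ⟨μ, hμ, v, hvS, w, hwS, hvv, hww, hvw, hAv, hAw, hBv, hBw⟩ :=
      exists_plane_normal_form hA hB hsq hanti hAS hBS (by omega)
    have hwv : ⟪w, v⟫_ℝ = 0 := by rw [real_inner_comm, hvw]
    set U := Submodule.span ℝ ({v, w} : Set E)
    have hUS : U ≤ S := Submodule.span_le.mpr (by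
      rintro x (rfl | rfl) <;> assumption)
    have hperp : ∀ x, x ∈ Uᗮ ↔ ⟪v, x⟫_ℝ = 0 ∧ ⟪w, x⟫_ℝ = 0 := fun x => by
      rw [Submodule.mem_orthogonal]
      refine ⟨fun h => ⟨h v (Submodule.subset_span (by simp)),
        h w (Submodule.subset_span (by simp))⟩, fun h y hy => ?_⟩
      obtain ⟨s, t, rfl⟩ := Submodule.mem_span_pair.mp hy
      simp [inner_add_left, inner_smul_left, h]
    have hon : Orthonormal ℝ ![v, w] := by
      rw [orthonormal_iff_ite]
      intro i j
      fin_cases i <;> fin_cases j <;> simp [hvv, hww, hvw, hwv, -inner_self_eq_norm_sq_to_K]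
    have hU : Module.finrank ℝ U = 2 := by
      have := finrank_span_eq_card hon.linearIndependent
      rwa [Matrix.range_cons, Matrix.range_cons, Matrix.range_empty, Set.union_empty,
        Set.singleton_union, Fintype.card_fin] at this
    have hfr := Submodule.finrank_add_inf_finrank_orthogonal hUS
    obtain ⟨f, c, hfS, hc, hf, hfA, hfB⟩ := ih (Uᗮ ⊓ S)
      (fun x hx => ⟨by
        obtain ⟨h1, h2⟩ := (hperp x).mp hx.1
        rw [SetLike.mem_coe, hperp, ← hA, ← hA, hAv, hAw]
        simp [inner_smul_left, h1, h2], hAS x hx.2⟩)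
      (fun x hx => ⟨by
        obtain ⟨h1, h2⟩ := (hperp x).mp hx.1
        rw [SetLike.mem_coe, hperp, ← hB, ← hB, hBv, hBw]
        simp [inner_smul_left, h1, h2], hBS x hx.2⟩) (by omega)
    have hfv : ∀ i < n, ⟪v, f i⟫_ℝ = 0 ∧ ⟪w, f i⟫_ℝ = 0 := fun i hi => (hperp _).mp (hfS i hi).1
    have hfv' : ∀ i < n, ⟪f i, v⟫_ℝ = 0 ∧ ⟪f i, w⟫_ℝ = 0 := fun i hi => by
      rw [real_inner_comm, real_inner_comm w]; exact hfv i hi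
    have hdecomp : ∀ x ∈ S, ∃ y ∈ Uᗮ ⊓ S, x = ⟪v, x⟫_ℝ • v + ⟪w, x⟫_ℝ • w + y ∧
        ∀ i < n, ⟪f i, y⟫_ℝ = ⟪f i, x⟫_ℝ := fun x hx =>
      ⟨x - (⟪v, x⟫_ℝ • v + ⟪w, x⟫_ℝ • w), ⟨by
        rw [SetLike.mem_coe, hperp]
        simp only [inner_sub_right, inner_add_right, inner_smul_right, hvv, hww, hvw, hwv]
        constructor <;> ring, S.sub_mem hx (S.add_mem (S.smul_mem _ hvS) (S.smul_mem _ hwS))⟩,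
        by abel, fun i hi => by simp [inner_sub_right, inner_add_right, inner_smul_right, hfv' i hi]⟩
    refine ⟨fun i => match i with | 0 => v | 1 => w | i + 2 => f i,
      fun j => match j with | 0 => μ | j + 1 => c j, ?_, ?_, ?_, ?_, ?_⟩
    · rintro (_ | _ | i) hi
      exacts [hvS, hwS, (hfS i (by omega)).2]
    · rintro (_ | j)
      exacts [hμ, hc j]
    · rintro (_ | _ | i) hi (_ | _ | j) hj
      · simpa using hvv
      · simpa using hvw
      · simpa using (hfv j (by omega)).1
      · simpa using hwv
      · simpa using hww
      · simpa using (hfv j (by omega)).2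
      · simpa using (hfv' i (by omega)).1
      · simpa using (hfv' i (by omega)).2
      · simpa using hf i (by omega) j (by omega)
    · intro x hx
      obtain ⟨y, hy, hxy, hfy⟩ := hdecomp x hx
      obtain ⟨h1, h2⟩ := (hperp y).mp hy.1
      have h3 : ⟪v, A y⟫_ℝ = 0 := by rw [← hA, hAv]; simp [inner_smul_left, h1]
      have h4 : ⟪w, A y⟫_ℝ = 0 := by rw [← hA, hAw]; simp [inner_smul_left, h2]
      have key : ⟪x, A x⟫_ℝ = μ * (⟪v, x⟫_ℝ ^ 2 - ⟪w, x⟫_ℝ ^ 2) + ⟪y, A y⟫_ℝ := by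
        generalize ⟪v, x⟫_ℝ = a at *
        generalize ⟪w, x⟫_ℝ = b at *
        rw [real_inner_comm] at h1 h2
        rw [hxy]
        simp only [map_add, map_smul, hAv, hAw, inner_add_left, inner_add_right, inner_smul_left,
          inner_smul_right, inner_neg_right, smul_neg, hvv, hww, hvw, hwv, h1, h2, h3, h4,
          conj_trivial]
        ring
      rw [show (n + 2) / 2 = n / 2 + 1 by omega, Finset.sum_range_succ', key, hfA y hy, add_comm]
      congr 1
      refine Finset.sum_congr rfl fun j hj => ?_
      rw [Finset.mem_range] at hj
      rw [hfy (2 * j) (by omega), hfy (2 * j + 1) (by omega)]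
      rfl
    · intro x hx
      obtain ⟨y, hy, hxy, hfy⟩ := hdecomp x hx
      obtain ⟨h1, h2⟩ := (hperp y).mp hy.1
      have h3 : ⟪v, B y⟫_ℝ = 0 := by rw [← hB, hBv]; simp [inner_smul_left, h2]
      have h4 : ⟪w, B y⟫_ℝ = 0 := by rw [← hB, hBw]; simp [inner_smul_left, h1]
      have key : ⟪x, B x⟫_ℝ = μ * (2 * ⟪v, x⟫_ℝ * ⟪w, x⟫_ℝ) + ⟪y, B y⟫_ℝ := by
        generalize ⟪v, x⟫_ℝ = a at *
        generalize ⟪w, x⟫_ℝ = b at *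
        rw [real_inner_comm] at h1 h2
        rw [hxy]
        simp only [map_add, map_smul, hBv, hBw, inner_add_left, inner_add_right, inner_smul_left,
          inner_smul_right, hvv, hww, hvw, hwv, h1, h2, h3, h4,
          conj_trivial]
        ring
      rw [show (n + 2) / 2 = n / 2 + 1 by omega, Finset.sum_range_succ', key, hfB y hy, add_comm]
      congr 1
      refine Finset.sum_congr rfl fun j hj => ?_
      rw [Finset.mem_range] at hj
      rw [hfy (2 * j) (by omega), hfy (2 * j + 1) (by omega)]
      rfl

end NormalForm

theorem Matrix.IsSymm.isSymmetric_toEuclideanLin {m : ℕ} {A : Matrix (Fin m) (Fin m) ℝ}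
    (hA : A.IsSymm) : (Matrix.toEuclideanLin A).IsSymmetric := by
  rwa [Matrix.isSymmetric_toEuclideanLin_iff, Matrix.IsHermitian,
    Matrix.conjTranspose_eq_transpose_of_trivial]

open scoped InnerProductSpace in
theorem inner_toLp_toEuclideanLin {m : ℕ} (A : Matrix (Fin m) (Fin m) ℝ) (x : Fin m → ℝ) :
    ⟪WithLp.toLp 2 x, Matrix.toEuclideanLin A (WithLp.toLp 2 x)⟫_ℝ = x ⬝ᵥ A *ᵥ x := by
  simp [PiLp.inner_apply, dotProduct, mul_comm]

theorem IsHarmonicMorphism.sum_mulVec_mul_mulVec {m n : ℕ} {φ : (Fin m → ℝ) → (Fin n → ℝ)}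
    {A : Fin n → Matrix (Fin m) (Fin m) ℝ} (hφ : IsHarmonicMorphism φ) (hA : Represents A φ) :
    ∃ c : (Fin m → ℝ) → ℝ, ∀ x α β,
      ∑ i, (A α *ᵥ x) i * (A β *ᵥ x) i = if α = β then c x else 0 := by
  obtain ⟨hsymm, -, hrep⟩ := hA
  obtain ⟨-, l, hl⟩ := hφ
  refine ⟨fun x => l x ^ 2 / 4, fun x α β => ?_⟩
  have h := hl x α β
  simp only [hrep, pderiv_dotProduct_mulVec _ (hsymm _)] at h
  have h4 : ∑ i, 2 * (A α *ᵥ x) i * (2 * (A β *ᵥ x) i) =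
      4 * ∑ i, (A α *ᵥ x) i * (A β *ᵥ x) i := by
    rw [Finset.mul_sum]
    exact Finset.sum_congr rfl fun i _ => by ring
  rw [h4] at h
  split_ifs at h ⊢ <;> linarith

/-- Every nonconstant quadratic harmonic morphism `ℝ^m → ℝ² ≅ ℂ` is
domain-equivalent to `x ↦ λ₁(x₁+ix₂)² + … + λₖ(x_{2k-1}+ix_{2k})²` with
`k = ⌊m/2⌋`, `λⱼ ≥ 0` not all zero: `φ = ψ ∘ G` for some orthogonal `G`. -/
theorem qhm_to_plane_classification (m : ℕ) (φ : (Fin m → ℝ) → Fin 2 → ℝ)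
    (hφ : IsQuadraticHM φ) (hnc : ∃ x y, φ x ≠ φ y) :
    ∃ lam : Fin (m / 2) → ℝ, (∀ j, 0 ≤ lam j) ∧ lam ≠ 0 ∧
      ∃ G : Matrix (Fin m) (Fin m) ℝ, IsOrthoMat G ∧
        ∀ x : Fin m → ℝ,
          (φ x 0 : ℂ) + (φ x 1 : ℂ) * Complex.I =
            ∑ j : Fin (m / 2),
              (lam j : ℂ) *
                ((G.mulVec x ⟨2 * (j : ℕ), by have := j.isLt; omega⟩ : ℂ) +
                    (G.mulVec x ⟨2 * (j : ℕ) + 1, by have := j.isLt; omega⟩ : ℂ) *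
                      Complex.I) ^ 2 := by
  obtain ⟨⟨A, hA⟩, hH⟩ := hφ
  obtain ⟨c, hc⟩ := hH.sum_mulVec_mul_mulVec hA
  obtain ⟨hsymm, -, hrep⟩ := hA
  have hT (α : Fin 2) := (hsymm α).isSymmetric_toEuclideanLin
  have hin (α β : Fin 2) (x : EuclideanSpace ℝ (Fin m)) :
      inner ℝ (Matrix.toEuclideanLin (A α) x) (Matrix.toEuclideanLin (A β) x) =
        if β = α then c x.ofLp else 0 := by
    rw [← hc x.ofLp β α]
    simp [PiLp.inner_apply]
  obtain ⟨hsq, hanti⟩ := (hT 0).comp_eq_comp_of_conformal (hT 1)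
    (fun x => by simp only [hin, if_true]) (fun x => by simp [hin])
  obtain ⟨v, l, -, hl, hv, h0, h1⟩ := exists_normal_form_on (hT 0) (hT 1) hsq hanti m ⊤
    (fun _ _ => trivial) (fun _ _ => trivial) (by simp)
  have hφ0 (x : Fin m → ℝ) := (hrep x 0).trans <|
    (inner_toLp_toEuclideanLin (A 0) x).symm.trans (h0 (WithLp.toLp 2 x) trivial)
  have hφ1 (x : Fin m → ℝ) := (hrep x 1).trans <|
    (inner_toLp_toEuclideanLin (A 1) x).symm.trans (h1 (WithLp.toLp 2 x) trivial)
  simp only [Finset.sum_range] at hφ0 hφ1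
  let G : Matrix (Fin m) (Fin m) ℝ := Matrix.of fun i j => v i j
  have hG (x : Fin m → ℝ) (i : ℕ) (hi : i < m) :
      (G *ᵥ x) ⟨i, hi⟩ = inner ℝ (v i) (WithLp.toLp 2 x) := by
    simp [G, PiLp.inner_apply, mulVec, dotProduct, mul_comm]
  refine ⟨fun j => l j, fun j => hl j, fun hz => ?_, G, ?_, fun x => ?_⟩
  · have hz' (j : Fin (m / 2)) : l j = 0 := congrFun hz j
    obtain ⟨x, y, hxy⟩ := hnc
    refine hxy (funext fun α => ?_)
    fin_cases α
    · simp [hφ0, hz']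
    · simp [hφ1, hz']
  · rw [IsOrthoMat, mul_eq_one_comm]
    ext i j
    simp only [Matrix.one_apply, Fin.ext_iff, ← hv i i.2 j j.2]
    simp [G, PiLp.inner_apply, Matrix.mul_apply, mul_comm]
  · rw [hφ0, hφ1]
    push_cast
    rw [Finset.sum_mul, ← Finset.sum_add_distrib]
    refine Finset.sum_congr rfl fun j _ => ?_
    rw [hG, hG]
    linear_combination
      (-(l j : ℂ) * (inner ℝ (v (2 * j + 1)) (WithLp.toLp 2 x) : ℝ) ^ 2) * Complex.I_sq
end
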